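/- zCDP group privacy (Theorem 4): Let T be a record set and let M be a mechanism mapping databases over T to probability measures on a measurable space Y satisfying ρ-zCDP. Then M guarantees (k²ρ)-zCDP for groups of size k: for every pair of databases D, D' over T whose multiset symmetric difference has cardinality at most k, and every α ∈ (1,∞), D_α(M(D)‖M(D')) ≤ (k²ρ)·α. -/

import Mathlib

open MeasureTheory ProbabilityTheory
open scoped Classical NNReal

/-- Rényi divergence of order `α` between two measures. -/
noncomputable def renyiDiv {X : Type*} [MeasurableSpace X] (α : ℝ) (P Q : Measure X) : EReal :=
  if P ≪ Q then (((α - 1)⁻¹ : ℝ) : EReal) * ENNReal.log (∫⁻ x, P.rnDeriv Q x ^ α ∂Q)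
  else ⊤

/-- Databases `D` and `D'` differ in the single record `r`. -/
def Neighbors {T : Type*} (D D' : Multiset T) (r : T) : Prop :=
  D' = r ::ₘ D ∨ D = r ::ₘ D'

/-- Per-record zero-concentrated differential privacy with policy function `P`. -/
def PRzCDP {T Y : Type*} [MeasurableSpace Y] (M : Multiset T → Measure Y) (P : T → ℝ) : Prop :=
  ∀ α : ℝ, 1 < α → ∀ (D D' : Multiset T) (r : T), Neighbors D D' r →
    renyiDiv α (M D) (M D') ≤ ((α * P r : ℝ) : EReal)

/-- Zero-concentrated differential privacy with privacy-loss parameter `ρ`. -/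
def zCDP {T Y : Type*} [MeasurableSpace Y] (M : Multiset T → Measure Y) (ρ : ℝ) : Prop :=
  ∀ α : ℝ, 1 < α → ∀ (D D' : Multiset T) (r : T), Neighbors D D' r →
    renyiDiv α (M D) (M D') ≤ ((ρ * α : ℝ) : EReal)

theorem renyiDiv_le_coe_iff {X : Type*} [MeasurableSpace X] {α : ℝ} (hα : 1 < α)
    (P Q : Measure X) (c : ℝ) :
    renyiDiv α P Q ≤ (c : EReal) ↔
      P ≪ Q ∧ ∫⁻ x, P.rnDeriv Q x ^ α ∂Q ≤ ENNReal.ofReal (Real.exp ((α - 1) * c)) := by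
  have hpos : 0 < α - 1 := sub_pos.mpr hα
  unfold renyiDiv
  split_ifs with hPQ
  · rw [← EReal.exp_coe, ← ENNReal.exp_log (lintegral _ _), EReal.exp_le_exp_iff, mul_comm]
    simp only [hPQ, true_and, EReal.log_exp]
    rw [← EReal.le_div_iff_mul_le (by exact_mod_cast inv_pos.mpr hpos) (EReal.coe_ne_top _),
      ← EReal.coe_div, div_inv_eq_mul, mul_comm c]
  · simp [hPQ]

theorem renyiDiv_self {X : Type*} [MeasurableSpace X] (α : ℝ) (P : Measure X)
    [IsProbabilityMeasure P] : renyiDiv α P P = 0 := by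
  have h : ∫⁻ x, P.rnDeriv P x ^ α ∂P = 1 := by
    rw [lintegral_congr_ae (g := fun _ => 1)]
    · simp
    · filter_upwards [P.rnDeriv_self] with x hx
      simp [hx]
  simp [renyiDiv, h, Measure.AbsolutelyContinuous.refl]

/-- Hölder's inequality for the moments of a likelihood ratio factored through `S`. -/
theorem lintegral_rnDeriv_rpow_le {X : Type*} [MeasurableSpace X] {P S Q : Measure X}
    [SigmaFinite P] [SigmaFinite S] [SigmaFinite Q] (hPS : P ≪ S) (hSQ : S ≪ Q)
    {α p q : ℝ} (hα : 1 < α) (hpq : p.HolderConjugate q) :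
    ∫⁻ x, P.rnDeriv Q x ^ α ∂Q ≤
      (∫⁻ x, P.rnDeriv S x ^ (α * p) ∂S) ^ (1 / p) *
        (∫⁻ x, S.rnDeriv Q x ^ ((α - 1 / p) * q) ∂Q) ^ (1 / q) := by
  have hp : 0 < 1 / p := one_div_pos.mpr hpq.pos
  have hp1 : 1 / p < 1 := (div_lt_one hpq.pos).mpr hpq.lt
  have hfactor : ∫⁻ x, P.rnDeriv Q x ^ α ∂Q =
      ∫⁻ x, ((fun x => P.rnDeriv S x ^ α * S.rnDeriv Q x ^ (1 / p)) *
        fun x => S.rnDeriv Q x ^ (α - 1 / p)) x ∂Q := by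
    refine lintegral_congr_ae ?_
    filter_upwards [Measure.rnDeriv_mul_rnDeriv (κ := Q) hPS] with x hx
    simp only [Pi.mul_apply] at hx ⊢
    rw [← hx, ENNReal.mul_rpow_of_nonneg _ _ (by linarith), mul_assoc,
      ← ENNReal.rpow_add_of_nonneg _ _ hp.le (by linarith), add_sub_cancel]
  have hleft : ∫⁻ x, (P.rnDeriv S x ^ α * S.rnDeriv Q x ^ (1 / p)) ^ p ∂Q =
      ∫⁻ x, P.rnDeriv S x ^ (α * p) ∂S := by
    rw [← lintegral_rnDeriv_mul hSQ (by fun_prop)]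
    refine lintegral_congr fun x => ?_
    rw [ENNReal.mul_rpow_of_nonneg _ _ hpq.nonneg, ← ENNReal.rpow_mul, ← ENNReal.rpow_mul,
      one_div_mul_cancel hpq.ne_zero, ENNReal.rpow_one, mul_comm]
  rw [hfactor, ← hleft]
  simp only [ENNReal.rpow_mul _ (α - 1 / p) q]
  exact ENNReal.lintegral_mul_le_Lp_mul_Lq Q hpq (by fun_prop) (by fun_prop)

/-- A weak triangle inequality for Rényi divergences growing linearly in the order. -/
theorem renyiDiv_le_of_forall_le {X : Type*} [MeasurableSpace X] {P S Q : Measure X}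
    [SigmaFinite P] [SigmaFinite S] [SigmaFinite Q] {ρ s : ℝ} (hs : 0 < s)
    (hPS : ∀ α : ℝ, 1 < α → renyiDiv α P S ≤ ((s ^ 2 * ρ * α : ℝ) : EReal))
    (hSQ : ∀ α : ℝ, 1 < α → renyiDiv α S Q ≤ ((ρ * α : ℝ) : EReal)) {α : ℝ} (hα : 1 < α) :
    renyiDiv α P Q ≤ (((s + 1) ^ 2 * ρ * α : ℝ) : EReal) := by
  have hα0 : 0 < α - 1 := sub_pos.mpr hα
  have hd : 0 < (s + 1) * α - 1 := by nlinarith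
  have hαs : 0 < α * s := by positivity
  have hd' : α * (s + 1) - 1 ≠ 0 := by rw [mul_comm]; exact hd.ne'
  have hpq : (((s + 1) * α - 1) / (α * s)).HolderConjugate (((s + 1) * α - 1) / (α - 1)) := by
    rw [Real.holderConjugate_iff]
    refine ⟨by rw [lt_div_iff₀ hαs]; linarith, ?_⟩
    field_simp
    ring
  have hp : α * (((s + 1) * α - 1) / (α * s)) = ((s + 1) * α - 1) / s := by
    field_simp
  have hq : (α - 1 / (((s + 1) * α - 1) / (α * s))) * (((s + 1) * α - 1) / (α - 1)) =
      (s + 1) * α := by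
    field_simp
    ring
  have hβ : 1 < ((s + 1) * α - 1) / s := by rw [lt_div_iff₀ hs]; nlinarith
  have hγ : 1 < (s + 1) * α := by linarith
  obtain ⟨hacPS, hIPS⟩ := (renyiDiv_le_coe_iff hβ P S _).mp (hPS _ hβ)
  obtain ⟨hacSQ, hISQ⟩ := (renyiDiv_le_coe_iff hγ S Q _).mp (hSQ _ hγ)
  refine (renyiDiv_le_coe_iff hα P Q _).mpr ⟨hacPS.trans hacSQ, ?_⟩
  have hHolder := lintegral_rnDeriv_rpow_le hacPS hacSQ hα hpq
  rw [hp, hq] at hHolder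
  refine hHolder.trans ((mul_le_mul'
    (ENNReal.rpow_le_rpow hIPS (one_div_nonneg.mpr hpq.nonneg))
    (ENNReal.rpow_le_rpow hISQ (one_div_nonneg.mpr hpq.symm.nonneg))).trans_eq ?_)
  rw [ENNReal.ofReal_rpow_of_pos (Real.exp_pos _), ENNReal.ofReal_rpow_of_pos (Real.exp_pos _),
    ← ENNReal.ofReal_mul (by positivity), ← Real.exp_mul, ← Real.exp_mul, ← Real.exp_add]
  congr 2
  field_simp
  ring

/-- Two databases at symmetric difference at most `n + 1` are joined by a database at symmetric
difference at most `n` from the first and adjacent to the second, unless they are equal. -/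
theorem exists_neighbors_card_le {T : Type*} {n : ℕ} {D D' : Multiset T}
    (hne : D ≠ D') (h : Multiset.card ((D - D') + (D' - D)) ≤ n + 1) :
    ∃ E r, Multiset.card ((D - E) + (E - D)) ≤ n ∧ Neighbors E D' r := by
  by_cases hle : D ≤ D'
  · have hnle : ¬ D' ≤ D := fun h' => hne (le_antisymm hle h')
    obtain ⟨r, hr⟩ := Multiset.exists_mem_of_ne_zero (mt tsub_eq_zero_iff_le.mp hnle)
    have hcount : D.count r < D'.count r := Multiset.mem_sub.mp hr
    refine ⟨D'.erase r, r, ?_, .inl (Multiset.cons_erase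
      (Multiset.count_pos.mp (by omega))).symm⟩
    have heq : (D - D') + (D' - D) = r ::ₘ ((D - D'.erase r) + (D'.erase r - D)) := by
      ext a
      by_cases ha : a = r
      · subst ha
        simp
        omega
      · simp [ha]
    rw [heq, Multiset.card_cons] at h
    omega
  · obtain ⟨r, hr⟩ := Multiset.exists_mem_of_ne_zero (mt tsub_eq_zero_iff_le.mp hle)
    have hcount : D'.count r < D.count r := Multiset.mem_sub.mp hr
    refine ⟨r ::ₘ D', r, ?_, .inr rfl⟩
    have heq : (D - D') + (D' - D) = r ::ₘ ((D - r ::ₘ D') + (r ::ₘ D' - D)) := by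
      ext a
      by_cases ha : a = r
      · subst ha
        simp only [Multiset.count_add, Multiset.count_sub, Multiset.count_cons_self]
        omega
      · simp [ha]
    rw [heq, Multiset.card_cons] at h
    omega

/-- zCDP group privacy (Theorem 4). -/
theorem zcdp_group_privacy {T Y : Type*} [MeasurableSpace Y]
    (ρ : ℝ) (hρ : 0 ≤ ρ)
    (M : Multiset T → Measure Y) (hMprob : ∀ D, IsProbabilityMeasure (M D))
    (hM : zCDP M ρ) (k : ℕ) (D D' : Multiset T)
    (hDD' : Multiset.card ((D - D') + (D' - D)) ≤ k) :
    ∀ α : ℝ, 1 < α →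
      renyiDiv α (M D) (M D') ≤ (((k : ℝ) ^ 2 * ρ * α : ℝ) : EReal) := by
  induction k generalizing D' with
  | zero =>
    intro α _
    have hzero := Multiset.card_eq_zero.mp (Nat.le_zero.mp hDD')
    obtain ⟨h₁, h₂⟩ := add_eq_zero.mp hzero
    obtain rfl := le_antisymm (tsub_eq_zero_iff_le.mp h₁) (tsub_eq_zero_iff_le.mp h₂)
    simp [renyiDiv_self]
  | succ n ih =>
    intro α hα
    by_cases hne : D = D'
    · subst hne
      rw [renyiDiv_self]
      exact_mod_cast (by positivity : 0 ≤ ((n + 1 : ℕ) : ℝ) ^ 2 * ρ * α)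
    obtain ⟨E, r, hDE, hED'⟩ := exists_neighbors_card_le hne hDD'
    rcases Nat.eq_zero_or_pos n with rfl | hn
    · have hzero := Multiset.card_eq_zero.mp (Nat.le_zero.mp hDE)
      obtain ⟨h₁, h₂⟩ := add_eq_zero.mp hzero
      obtain rfl := le_antisymm (tsub_eq_zero_iff_le.mp h₁) (tsub_eq_zero_iff_le.mp h₂)
      simpa using hM α hα _ _ r hED'
    · rw [Nat.cast_succ]
      exact renyiDiv_le_of_forall_le (by exact_mod_cast hn) (ih E hDE)
        (fun β hβ => hM β hβ _ _ r hED') hα
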